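/- arXiv:1503.08329 — 2 statements merged into one kernel-verified Lean document; each statement's English description precedes it below -/
import Mathlib

section
/- For any probability distribution Q on a set H of voters f : X → [-1,1] and any probability distribution D' on X × {-1,1}, the expected disagreement satisfies d_Q^{D'} ≤ 2·R_{D'}(G_Q)·(1 − R_{D'}(G_Q)) ≤ 1/2; moreover, if d_Q^{D'} = 1/2 then R_{D'}(G_Q) = 1/2. -/
open MeasureTheory

/-- The margin of the `Q`-weighted majority vote on an example `p = (x, y)`:
`M_Q(x,y) = y * E_{f ∼ Q} f(x)`. -/
noncomputable def margin {X ι : Type*} [MeasurableSpace ι] (F : ι → X → ℝ)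
    (Q : Measure ι) (p : X × ℝ) : ℝ :=
  p.2 * ∫ i, F i p.1 ∂Q

/-- First moment of the margin under `D'`. -/
noncomputable def mu1 {X ι : Type*} [MeasurableSpace X] [MeasurableSpace ι]
    (F : ι → X → ℝ) (Q : Measure ι) (D' : Measure (X × ℝ)) : ℝ :=
  ∫ p, margin F Q p ∂D'

/-- Second moment of the margin under `D'`. -/
noncomputable def mu2 {X ι : Type*} [MeasurableSpace X] [MeasurableSpace ι]
    (F : ι → X → ℝ) (Q : Measure ι) (D' : Measure (X × ℝ)) : ℝ :=
  ∫ p, (margin F Q p) ^ 2 ∂D'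

/-- Gibbs risk: `R_{D'}(G_Q) = (1 - μ₁(M_Q^{D'})) / 2`. -/
noncomputable def gibbsRisk {X ι : Type*} [MeasurableSpace X] [MeasurableSpace ι]
    (F : ι → X → ℝ) (Q : Measure ι) (D' : Measure (X × ℝ)) : ℝ :=
  (1 - mu1 F Q D') / 2

/-- Expected disagreement: `d_Q^{D'} = (1 - μ₂(M_Q^{D'})) / 2`. -/
noncomputable def disagreement {X ι : Type*} [MeasurableSpace X] [MeasurableSpace ι]
    (F : ι → X → ℝ) (Q : Measure ι) (D' : Measure (X × ℝ)) : ℝ :=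
  (1 - mu2 F Q D') / 2

/-- The margin is bounded by one in absolute value at every example with label `1` or `-1`. -/
theorem abs_margin_le_one {X ι : Type*} [MeasurableSpace ι]
    {F : ι → X → ℝ} (hF : ∀ i x, F i x ∈ Set.Icc (-1 : ℝ) 1)
    (Q : Measure ι) [IsProbabilityMeasure Q] {p : X × ℝ} (hp : p.2 = 1 ∨ p.2 = -1) :
    |margin F Q p| ≤ 1 := by
  have hI : ‖∫ i, F i p.1 ∂Q‖ ≤ 1 := by
    simpa using norm_integral_le_of_norm_le_const (μ := Q) (f := fun i => F i p.1) (C := 1)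
      (ae_of_all _ fun i => abs_le.2 (hF i p.1))
  rw [Real.norm_eq_abs] at hI
  rcases hp with hp | hp <;> simpa [margin, hp] using hI

/-- The margin is square integrable. -/
theorem memLp_margin {X ι : Type*} [MeasurableSpace X] [MeasurableSpace ι]
    {F : ι → X → ℝ} (hF : ∀ i x, F i x ∈ Set.Icc (-1 : ℝ) 1)
    (Q : Measure ι) [IsProbabilityMeasure Q]
    (D' : Measure (X × ℝ)) [IsProbabilityMeasure D']
    (hY : ∀ᵐ p ∂D', p.2 = 1 ∨ p.2 = -1)
    (hmeas : Measurable fun x : X => ∫ i, F i x ∂Q) :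
    MemLp (margin F Q) 2 D' := by
  have hm : Measurable (margin F Q) := measurable_snd.mul (hmeas.comp measurable_fst)
  exact MemLp.of_bound hm.aestronglyMeasurable 1
    (hY.mono fun p hp => abs_margin_le_one hF Q hp)

/-- The square of the mean of the margin is at most its second moment. -/
theorem mu1_sq_le_mu2 {X ι : Type*} [MeasurableSpace X] [MeasurableSpace ι]
    {F : ι → X → ℝ} (hF : ∀ i x, F i x ∈ Set.Icc (-1 : ℝ) 1)
    (Q : Measure ι) [IsProbabilityMeasure Q]
    (D' : Measure (X × ℝ)) [IsProbabilityMeasure D']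
    (hY : ∀ᵐ p ∂D', p.2 = 1 ∨ p.2 = -1)
    (hmeas : Measurable fun x : X => ∫ i, F i x ∂Q) :
    mu1 F Q D' ^ 2 ≤ mu2 F Q D' := by
  have hvar := ProbabilityTheory.variance_eq_sub (memLp_margin hF Q D' hY hmeas)
  have hnonneg := ProbabilityTheory.variance_nonneg (margin F Q) D'
  simp only [Pi.pow_apply] at hvar
  unfold mu1 mu2
  linarith

/-- The expected disagreement satisfies
`d_Q^{D'} ≤ 2 · R_{D'}(G_Q) · (1 - R_{D'}(G_Q)) ≤ 1/2`; moreover if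
`d_Q^{D'} = 1/2` then `R_{D'}(G_Q) = 1/2`. -/
theorem statement2
    {X ι : Type*} [MeasurableSpace X] [MeasurableSpace ι]
    (F : ι → X → ℝ) (hF : ∀ i x, F i x ∈ Set.Icc (-1 : ℝ) 1)
    (Q : Measure ι) [IsProbabilityMeasure Q]
    (D' : Measure (X × ℝ)) [IsProbabilityMeasure D']
    (hY : ∀ᵐ p ∂D', p.2 = 1 ∨ p.2 = -1)
    (hmeas : Measurable fun x : X => ∫ i, F i x ∂Q) :
    disagreement F Q D' ≤ 2 * gibbsRisk F Q D' * (1 - gibbsRisk F Q D') ∧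
    2 * gibbsRisk F Q D' * (1 - gibbsRisk F Q D') ≤ 1 / 2 ∧
    (disagreement F Q D' = 1 / 2 → gibbsRisk F Q D' = 1 / 2) := by
  have h := mu1_sq_le_mu2 hF Q D' hY hmeas
  unfold disagreement gibbsRisk
  refine ⟨by nlinarith, by nlinarith [sq_nonneg (mu1 F Q D')], fun hd => ?_⟩
  have hzero : mu1 F Q D' = 0 := pow_eq_zero_iff two_ne_zero |>.1
    (le_antisymm (by linarith) (sq_nonneg _))
  rw [hzero]
  norm_num
end

section
/- For any distribution D on X × Y, any set H of voters f : X → [-1,1], any loss L : [-1,1] × Y → [0,1], any prior distribution P on H, and any δ ∈ (0,1]: with probability at least 1 − δ over the draw of S ∼ D^m, simultaneously for all posterior distributions Q on H, kl(E_{f∼Q} E_{L,S}(f) ‖ E_{f∼Q} E_{L,D}(f)) ≤ (1/m)·[KL(Q‖P) + ln(ξ(m)/δ)]. -/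
open MeasureTheory

open Classical in
/-- Kullback–Leibler divergence `KL(Q‖P) = E_{f∼Q} ln (dQ/dP)(f)`, with value `⊤`
when `Q` is not absolutely continuous w.r.t. `P` or the divergence is not finite. -/
noncomputable def klDivE {ι : Type*} [MeasurableSpace ι] (Q P : Measure ι) : EReal :=
  if Q ≪ P ∧ Integrable (fun i => Real.log ((Q.rnDeriv P) i).toReal) Q
  then ((∫ i, Real.log ((Q.rnDeriv P) i).toReal ∂Q : ℝ) : EReal)
  else ⊤

/-- `kl(q‖p)`: the KL divergence between Bernoulli distributions of parameters `q`, `p`. -/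
noncomputable def klBin (q p : ℝ) : ℝ :=
  q * Real.log (q / p) + (1 - q) * Real.log ((1 - q) / (1 - p))

/-- `ξ(m) = Σ_{k=0}^m C(m,k)·(k/m)^k·(1 - k/m)^{m-k}` (with `0⁰ = 1`). -/
noncomputable def xi (m : ℕ) : ℝ :=
  ∑ k ∈ Finset.range (m + 1),
    (m.choose k : ℝ) * ((k : ℝ) / (m : ℝ)) ^ k * (1 - (k : ℝ) / (m : ℝ)) ^ (m - k)

/-- Empirical expected loss of voter `i` on the sample `S`. -/
noncomputable def empLoss {X ι : Type*} (L : ℝ → ℝ → ℝ) (F : ι → X → ℝ) {m : ℕ}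
    (S : Fin m → X × ℝ) (i : ι) : ℝ :=
  (m : ℝ)⁻¹ * ∑ k, L (F i (S k).1) (S k).2

/-- True expected loss of voter `i` under `D`. -/
noncomputable def trueLoss {X ι : Type*} [MeasurableSpace X] (L : ℝ → ℝ → ℝ)
    (F : ι → X → ℝ) (D : Measure (X × ℝ)) (i : ι) : ℝ :=
  ∫ p, L (F i p.1) p.2 ∂D

lemma sum_powerset_prod_mul_card {α : Type*} [Fintype α] [DecidableEq α] (x : α → ℝ) :
    ∑ B ∈ (Finset.univ : Finset α).powerset,
      ((∏ k ∈ B, x k) * ∏ k ∈ Finset.univ \ B, (1 - x k)) * (B.card : ℝ) = ∑ k, x k := by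
  have h1 : ∀ k, ∑ B ∈ (Finset.univ : Finset α).powerset,
      ((∏ j ∈ B, x j) * ∏ j ∈ Finset.univ \ B, (1 - x j)) * (if k ∈ B then 1 else 0) = x k := by
    intro k
    have h2 := Finset.prod_add (fun j => x j * (if j = k then 0 else 1)) (fun j => 1 - x j)
      Finset.univ
    have h3 := Finset.prod_add x (fun j => 1 - x j) Finset.univ
    have h4 : ∏ j, (x j * (if j = k then 0 else 1) + (1 - x j)) = 1 - x k := by
      rw [Finset.prod_eq_single k]
      · simp
      · intro j _ hj; simp [hj]
      · simp
    rw [h4] at h2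
    simp only [add_sub_cancel, Finset.prod_const_one] at h3
    have h5 : x k = (∑ B ∈ (Finset.univ : Finset α).powerset,
        (∏ j ∈ B, x j) * ∏ j ∈ Finset.univ \ B, (1 - x j)) - (1 - x k) := by
      rw [← h3]; ring
    rw [h2] at h5
    refine Eq.trans ?_ h5.symm
    rw [← Finset.sum_sub_distrib]
    refine Finset.sum_congr rfl fun B _ => ?_
    rw [Finset.prod_mul_distrib]
    by_cases hk : k ∈ B
    · rw [Finset.prod_eq_zero (f := fun j => if j = k then (0 : ℝ) else 1) hk (by simp)]
      simp [hk]
    · rw [Finset.prod_eq_one (f := fun j => if j = k then (0 : ℝ) else 1)]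
      · simp [hk]
      · intro j hj
        rw [if_neg]
        rintro rfl
        exact hk hj
  calc _ = ∑ B ∈ (Finset.univ : Finset α).powerset, ∑ k,
      ((∏ j ∈ B, x j) * ∏ j ∈ Finset.univ \ B, (1 - x j)) * (if k ∈ B then 1 else 0) := by
        refine Finset.sum_congr rfl fun B _ => ?_
        rw [← Finset.mul_sum]
        simp
    _ = _ := by
        rw [Finset.sum_comm]
        exact Finset.sum_congr rfl fun k _ => h1 k

/-- A convex function of the mean of `m` numbers in `[0, 1]` is at most its expectation when the
numbers are replaced by independent Bernoulli variables with the same means. -/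
lemma ConvexOn.map_mean_le_sum_powerset {G : ℝ → ℝ} (hG : ConvexOn ℝ (Set.Icc 0 1) G) {m : ℕ}
    (hm : 0 < m) (x : Fin m → ℝ) (hx : ∀ k, x k ∈ Set.Icc (0 : ℝ) 1) :
    G ((m : ℝ)⁻¹ * ∑ k, x k) ≤ ∑ B ∈ (Finset.univ : Finset (Fin m)).powerset,
      ((∏ k ∈ B, x k) * ∏ k ∈ Finset.univ \ B, (1 - x k)) * G ((B.card : ℝ) / m) := by
  have hm' : (0 : ℝ) < m := by exact_mod_cast hm
  have hsum : ∑ B ∈ (Finset.univ : Finset (Fin m)).powerset,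
      ((∏ k ∈ B, x k) * ∏ k ∈ Finset.univ \ B, (1 - x k)) = 1 := by
    rw [← Finset.prod_add]; simp
  have := hG.map_sum_le (t := (Finset.univ : Finset (Fin m)).powerset)
    (w := fun B => (∏ k ∈ B, x k) * ∏ k ∈ Finset.univ \ B, (1 - x k))
    (p := fun B => (B.card : ℝ) / m)
    (fun B _ => mul_nonneg (Finset.prod_nonneg fun k _ => (hx k).1)
      (Finset.prod_nonneg fun k _ => sub_nonneg.2 (hx k).2)) hsum
    (fun B _ => ⟨by positivity, by
      rw [div_le_one hm']
      exact Nat.cast_le.2 ((Finset.card_le_univ B).trans_eq (Fintype.card_fin m))⟩)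
  simp only [smul_eq_mul] at this
  convert this using 1
  congr 1
  rw [← sum_powerset_prod_mul_card x, Finset.mul_sum]
  congr 1
  refine Finset.sum_congr rfl fun B _ => ?_
  field_simp

lemma convexOn_klBin_left {p : ℝ} (hp0 : p ≠ 0) (hp1 : p ≠ 1) :
    ConvexOn ℝ (Set.Icc 0 1) fun q => klBin q p := by
  have h1 : ConvexOn ℝ (Set.Icc 0 1) fun q : ℝ => q * Real.log q :=
    Real.convexOn_mul_log.subset Set.Icc_subset_Ici_self (convex_Icc 0 1)
  have h2 : ConvexOn ℝ (Set.Icc 0 1) fun q : ℝ => (1 - q) * Real.log (1 - q) := by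
    have := Real.convexOn_mul_log.comp_affineMap (AffineMap.lineMap (1 : ℝ) (0 : ℝ))
    refine (this.subset (fun q hq => ?_) (convex_Icc 0 1)).congr fun q _ => ?_
    · simp [AffineMap.lineMap_apply]; linarith [hq.2]
    · simp [AffineMap.lineMap_apply, sub_eq_neg_add]
  have h3 : ConvexOn ℝ (Set.Icc (0 : ℝ) 1)
      fun q : ℝ => q * (Real.log (1 - p) - Real.log p) - Real.log (1 - p) := by
    refine ⟨convex_Icc 0 1, fun x _ y _ a b _ _ hab => le_of_eq ?_⟩
    simp only [smul_eq_mul]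
    linear_combination Real.log (1 - p) * hab
  refine ((h1.add h2).add h3).congr fun q _ => ?_
  have h4 : q * Real.log (q / p) = q * (Real.log q - Real.log p) := by
    by_cases hq : q = 0
    · simp [hq]
    · rw [Real.log_div hq hp0]
  have h5 : (1 - q) * Real.log ((1 - q) / (1 - p)) =
      (1 - q) * (Real.log (1 - q) - Real.log (1 - p)) := by
    by_cases hq : 1 - q = 0
    · simp [hq]
    · rw [Real.log_div hq (sub_ne_zero.2 hp1.symm)]
  simp only [Pi.add_apply, klBin]
  rw [h4, h5]
  ring

lemma convexOn_exp_mul_klBin (m : ℕ) {p : ℝ} (hp0 : p ≠ 0) (hp1 : p ≠ 1) :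
    ConvexOn ℝ (Set.Icc 0 1) fun q => Real.exp (m * klBin q p) := by
  have h := (convexOn_klBin_left hp0 hp1).smul (Nat.cast_nonneg (α := ℝ) m)
  refine ⟨convex_Icc 0 1, fun x hx y hy a b ha hb hab => ?_⟩
  exact (Real.exp_le_exp.2 (h.2 hx hy ha hb hab)).trans
    (convexOn_exp.2 (Set.mem_univ _) (Set.mem_univ _) ha hb hab)

lemma exp_mul_klBin_mul {m k : ℕ} (hm : 0 < m) (hk : k ≤ m) {p : ℝ} (hp0 : 0 < p) (hp1 : p < 1) :
    p ^ k * (1 - p) ^ (m - k) * Real.exp (m * klBin (k / m) p) =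
      ((k : ℝ) / m) ^ k * (1 - (k : ℝ) / m) ^ (m - k) := by
  have hm' : (0 : ℝ) < m := by exact_mod_cast hm
  have key : ∀ (n : ℕ) {q r : ℝ}, 0 < r → (n : ℝ) = m * q →
      r ^ n * Real.exp (m * (q * Real.log (q / r))) = q ^ n := by
    intro n q r hr hn
    rcases Nat.eq_zero_or_pos n with rfl | hpos
    · have : q = 0 := by
        simpa [hm'.ne'] using hn.symm
      simp [this]
    · have hn' : (0 : ℝ) < n := by exact_mod_cast hpos
      have hq : 0 < q := by
        by_contra! h
        nlinarith
      rw [← mul_assoc, ← hn, Real.exp_nat_mul, Real.exp_log (by positivity), ← mul_pow,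
        mul_div_cancel₀ _ hr.ne']
  rw [klBin, mul_add, Real.exp_add]
  have h1 := key k (q := (k : ℝ) / m) hp0 (by field_simp)
  have h2 := key (m - k) (q := 1 - (k : ℝ) / m) (r := 1 - p) (by linarith)
    (by push_cast [hk]; field_simp)
  rw [← h1, ← h2]
  ring

lemma one_le_xi (m : ℕ) : 1 ≤ xi m := by
  have := Finset.single_le_sum (s := Finset.range (m + 1)) (a := 0)
    (f := fun k : ℕ =>
      (m.choose k : ℝ) * ((k : ℝ) / (m : ℝ)) ^ k * (1 - (k : ℝ) / (m : ℝ)) ^ (m - k))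
    (fun k hk => ?_) (by simp)
  · simpa [xi] using this
  · have hk' : (k : ℝ) ≤ m := by exact_mod_cast Nat.lt_succ_iff.1 (Finset.mem_range.1 hk)
    have : (k : ℝ) / m ≤ 1 := div_le_one_of_le₀ hk' (by positivity)
    have : 0 ≤ 1 - (k : ℝ) / m := by linarith
    positivity

/-- `exp (m * kl(q‖p))`, with the correct value `⊤` where the Bernoulli distribution of parameter `q`
is not absolutely continuous with respect to that of parameter `p`. -/
noncomputable def expKl (m : ℕ) (q p : ℝ) : ENNReal :=
  open Classical in
  if (p = 0 → q = 0) ∧ (p = 1 → q = 1) then ENNReal.ofReal (Real.exp (m * klBin q p)) else ⊤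

lemma measurable_expKl (m : ℕ) : Measurable fun z : ℝ × ℝ => expKl m z.1 z.2 := by
  unfold expKl klBin
  refine Measurable.ite ?_ (by fun_prop) measurable_const
  have h1 : MeasurableSet {z : ℝ × ℝ | z.2 = 0} := measurable_snd (measurableSet_singleton 0)
  have h2 : MeasurableSet {z : ℝ × ℝ | z.2 = 1} := measurable_snd (measurableSet_singleton 1)
  have h3 : MeasurableSet {z : ℝ × ℝ | z.1 = 0} := measurable_fst (measurableSet_singleton 0)
  have h4 : MeasurableSet {z : ℝ × ℝ | z.1 = 1} := measurable_fst (measurableSet_singleton 1)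
  exact (h1.imp h3).inter (h2.imp h4)

lemma integral_sum_powerset_bernoulli {Ω : Type*} [MeasurableSpace Ω] {μ : Measure Ω}
    [IsProbabilityMeasure μ] {ℓ : Ω → ℝ} (hℓ : Integrable ℓ μ) (m : ℕ) (G : ℝ → ℝ) :
    Integrable (fun S : Fin m → Ω => ∑ B ∈ (Finset.univ : Finset (Fin m)).powerset,
      ((∏ k ∈ B, ℓ (S k)) * ∏ k ∈ Finset.univ \ B, (1 - ℓ (S k))) * G ((B.card : ℝ) / m))
      (Measure.pi fun _ => μ) ∧
    ∫ S : Fin m → Ω, ∑ B ∈ (Finset.univ : Finset (Fin m)).powerset,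
      ((∏ k ∈ B, ℓ (S k)) * ∏ k ∈ Finset.univ \ B, (1 - ℓ (S k))) * G ((B.card : ℝ) / m)
      ∂(Measure.pi fun _ => μ) =
    ∑ k ∈ Finset.range (m + 1), (m.choose k : ℝ) *
      ((∫ ω, ℓ ω ∂μ) ^ k * (1 - ∫ ω, ℓ ω ∂μ) ^ (m - k) * G (k / m)) := by
  have hprod : ∀ (B : Finset (Fin m)) (S : Fin m → Ω),
      (∏ k ∈ B, ℓ (S k)) * ∏ k ∈ Finset.univ \ B, (1 - ℓ (S k)) =
        ∏ k, (B.piecewise (fun _ => ℓ) (fun _ ω => 1 - ℓ ω) k) (S k) := by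
    intro B S
    have := Finset.prod_piecewise Finset.univ B (fun k => ℓ (S k)) (fun k => 1 - ℓ (S k))
    rw [Finset.univ_inter] at this
    rw [← this]
    refine Finset.prod_congr rfl fun k _ => ?_
    by_cases hk : k ∈ B <;> simp [hk]
  have h_int : ∀ B : Finset (Fin m), Integrable (fun S : Fin m → Ω =>
      ∏ k, (B.piecewise (fun _ => ℓ) (fun _ ω => 1 - ℓ ω) k) (S k)) (Measure.pi fun _ => μ) := by
    intro B
    refine Integrable.fintype_prod fun k => ?_
    by_cases hk : k ∈ B
    · simpa [hk] using hℓ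
    · simp only [hk, not_false_eq_true, Finset.piecewise_eq_of_notMem]
      exact (integrable_const (1 : ℝ)).sub hℓ
  simp only [hprod]
  refine ⟨integrable_finsetSum _ fun B _ => (h_int B).mul_const _, ?_⟩
  rw [integral_finsetSum _ fun B _ => (h_int B).mul_const _]
  have hval : ∀ B : Finset (Fin m),
      ∫ S : Fin m → Ω, (∏ k, (B.piecewise (fun _ => ℓ) (fun _ ω => 1 - ℓ ω) k) (S k)) *
        G ((B.card : ℝ) / m) ∂(Measure.pi fun _ => μ) =
      (∫ ω, ℓ ω ∂μ) ^ B.card * (1 - ∫ ω, ℓ ω ∂μ) ^ (m - B.card) * G ((B.card : ℝ) / m) := by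
    intro B
    rw [integral_mul_const, integral_fintype_prod_eq_prod]
    congr 1
    have := Finset.prod_piecewise Finset.univ B (fun _ => ∫ ω, ℓ ω ∂μ)
      (fun _ => 1 - ∫ ω, ℓ ω ∂μ)
    rw [Finset.univ_inter, Finset.prod_const, Finset.prod_const, ← Finset.compl_eq_univ_sdiff,
      Finset.card_compl, Fintype.card_fin] at this
    rw [← this]
    refine Finset.prod_congr rfl fun k _ => ?_
    by_cases hk : k ∈ B
    · simp [hk]
    · simp only [hk, not_false_eq_true, Finset.piecewise_eq_of_notMem]
      rw [integral_sub (integrable_const _) hℓ]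
      simp
  simp only [hval]
  rw [Finset.sum_powerset_apply_card (fun k => (∫ ω, ℓ ω ∂μ) ^ k *
    (1 - ∫ ω, ℓ ω ∂μ) ^ (m - k) * G ((k : ℝ) / m))]
  simp

lemma lintegral_expKl_le_xi {Ω : Type*} [MeasurableSpace Ω] {μ : Measure Ω}
    [IsProbabilityMeasure μ] {ℓ : Ω → ℝ} (hℓ : Measurable ℓ)
    (h01 : ∀ᵐ ω ∂μ, ℓ ω ∈ Set.Icc (0 : ℝ) 1) {m : ℕ} (hm : 0 < m) :
    ∫⁻ S : Fin m → Ω, expKl m ((m : ℝ)⁻¹ * ∑ k, ℓ (S k)) (∫ ω, ℓ ω ∂μ)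
      ∂(Measure.pi fun _ => μ) ≤ ENNReal.ofReal (xi m) := by
  have hm' : (0 : ℝ) < m := by exact_mod_cast hm
  have h_int : Integrable ℓ μ := Integrable.of_bound hℓ.aestronglyMeasurable 1 <| by
    filter_upwards [h01] with ω hω
    rw [Real.norm_eq_abs, abs_of_nonneg hω.1]
    exact hω.2
  have hpi : ∀ {R : Ω → Prop}, (∀ᵐ ω ∂μ, R ω) →
      ∀ᵐ S : Fin m → Ω ∂(Measure.pi fun _ => μ), ∀ k, R (S k) := fun h =>
    ae_all_iff.2 fun k => Measure.tendsto_eval_ae_ae.eventually h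
  have hdegenerate : ∀ c : ℝ, c = 0 ∨ c = 1 → (∫ ω, ℓ ω ∂μ) = c → (∀ᵐ ω ∂μ, ℓ ω = c) →
      ∫⁻ S : Fin m → Ω, expKl m ((m : ℝ)⁻¹ * ∑ k, ℓ (S k)) (∫ ω, ℓ ω ∂μ)
        ∂(Measure.pi fun _ => μ) ≤ ENNReal.ofReal (xi m) := by
    intro c hc hmean hae
    have h1 : ∫⁻ S : Fin m → Ω, expKl m ((m : ℝ)⁻¹ * ∑ k, ℓ (S k)) (∫ ω, ℓ ω ∂μ)
        ∂(Measure.pi fun _ => μ) = ∫⁻ _ : Fin m → Ω, 1 ∂(Measure.pi fun _ => μ) := by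
      refine lintegral_congr_ae ?_
      filter_upwards [hpi hae] with S hS
      have : (m : ℝ)⁻¹ * ∑ k, ℓ (S k) = c := by
        simp [hS, hm'.ne']
      rw [this, hmean]
      rcases hc with rfl | rfl <;> simp [expKl, klBin]
    rw [h1]
    simpa using one_le_xi m
  set p := ∫ ω, ℓ ω ∂μ with hp
  have hp_nonneg : 0 ≤ p := integral_nonneg_of_ae (h01.mono fun ω h => h.1)
  have hsub : ∫ ω, (1 - ℓ ω) ∂μ = 1 - p := by
    rw [integral_sub (integrable_const _) h_int]; simp [hp]
  have hp_le : 0 ≤ 1 - p := hsub ▸ integral_nonneg_of_ae (h01.mono fun ω h => sub_nonneg.2 h.2)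
  rcases hp_nonneg.eq_or_lt with h0 | h0
  · refine hdegenerate 0 (Or.inl rfl) h0.symm ?_
    exact (integral_eq_zero_iff_of_nonneg_ae (h01.mono fun ω h => h.1) h_int).1 h0.symm
  rcases hp_le.eq_or_lt with h1 | h1
  · refine hdegenerate 1 (Or.inr rfl) (by linarith) ?_
    have := (integral_eq_zero_iff_of_nonneg_ae (h01.mono fun ω h => sub_nonneg.2 h.2)
      ((integrable_const (1 : ℝ)).sub h_int)).1 (hsub.trans h1.symm)
    filter_upwards [this] with ω hω
    simp only [Pi.zero_apply] at hω
    linarith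
  have hp1 : p < 1 := by linarith
  obtain ⟨hI, hval⟩ := integral_sum_powerset_bernoulli h_int m fun q => Real.exp (m * klBin q p)
  calc _ ≤ ∫⁻ S : Fin m → Ω, ENNReal.ofReal (∑ B ∈ (Finset.univ : Finset (Fin m)).powerset,
      ((∏ k ∈ B, ℓ (S k)) * ∏ k ∈ Finset.univ \ B, (1 - ℓ (S k))) *
        Real.exp (m * klBin ((B.card : ℝ) / m) p)) ∂(Measure.pi fun _ => μ) := by
        refine lintegral_mono_ae ?_
        filter_upwards [hpi h01] with S hS
        rw [expKl, if_pos ⟨fun h => absurd h h0.ne', fun h => absurd h hp1.ne⟩]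
        exact ENNReal.ofReal_le_ofReal
          ((convexOn_exp_mul_klBin m h0.ne' hp1.ne).map_mean_le_sum_powerset hm _ hS)
    _ = ENNReal.ofReal (xi m) := by
        rw [← ofReal_integral_eq_lintegral_ofReal hI, hval]
        · congr 1
          refine Finset.sum_congr rfl fun k hk => ?_
          rw [exp_mul_klBin_mul hm (Nat.lt_succ_iff.1 (Finset.mem_range.1 hk)) h0 hp1, mul_assoc]
        · filter_upwards [hpi h01] with S hS
          refine Finset.sum_nonneg fun B _ => mul_nonneg (mul_nonneg ?_ ?_) (Real.exp_nonneg _)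
          · exact Finset.prod_nonneg fun k _ => (hS k).1
          · exact Finset.prod_nonneg fun k _ => sub_nonneg.2 (hS k).2

lemma mul_log_div_add_sub_le {q p q' p' : ℝ} (hq : 0 ≤ q) (hp : 0 ≤ p) (hq' : 0 ≤ q')
    (hp' : 0 ≤ p') (hpq : p = 0 → q = 0) (hqq' : q' = 0 → q = 0) (hpp' : p' = 0 → p = 0) :
    q * Real.log (q' / p') + (q - p * (q' / p')) ≤ q * Real.log (q / p) := by
  rcases hq.eq_or_lt with rfl | hq0
  · have : 0 ≤ p * (q' / p') := by positivity
    simpa using this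
  have hp0 : 0 < p := hp.lt_of_ne' fun h => hq0.ne' (hpq h)
  have hq'0 : 0 < q' := hq'.lt_of_ne' fun h => hq0.ne' (hqq' h)
  have hp'0 : 0 < p' := hp'.lt_of_ne' fun h => hp0.ne' (hpp' h)
  have h1 := Real.one_sub_inv_le_log_of_pos (x := (q / p) / (q' / p')) (by positivity)
  rw [Real.log_div (by positivity) (by positivity)] at h1
  have h2 : q * (1 - ((q / p) / (q' / p'))⁻¹) = q - p * (q' / p') := by
    field_simp
  nlinarith [mul_le_mul_of_nonneg_left h1 hq]

lemma integral_sub_log_rnDeriv_le {ι : Type*} [MeasurableSpace ι] {Q P : Measure ι}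
    [IsProbabilityMeasure Q] [IsProbabilityMeasure P] (hQP : Q ≪ P)
    (hllr : Integrable (fun i => Real.log ((Q.rnDeriv P) i).toReal) Q)
    {g : ι → ℝ} (hg : Integrable g Q) {Φ : ι → ENNReal} (hΦ : Measurable Φ)
    (hgΦ : ∀ᵐ i ∂Q, ENNReal.ofReal (Real.exp (g i)) ≤ Φ i) {c : ℝ} (hc : 0 < c)
    (hΦc : ∫⁻ i, Φ i ∂P ≤ ENNReal.ofReal c) :
    ∫ i, g i ∂Q ≤ ∫ i, Real.log ((Q.rnDeriv P) i).toReal ∂Q + Real.log c := by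
  set r := Q.rnDeriv P with hr
  have hr_meas : Measurable r := Measure.measurable_rnDeriv Q P
  have hdiff := hg.sub hllr
  have hlin : ∫⁻ i, ENNReal.ofReal (Real.exp (g i - Real.log (r i).toReal)) ∂Q ≤
      ENNReal.ofReal c :=
    calc _ ≤ ∫⁻ i, Φ i * (r i)⁻¹ ∂Q := by
          refine lintegral_mono_ae ?_
          filter_upwards [hgΦ, Measure.rnDeriv_pos hQP, hQP.ae_le (Measure.rnDeriv_lt_top Q P)]
            with i hi hpos htop
          have hrpos : 0 < (r i).toReal := ENNReal.toReal_pos hpos.ne' htop.ne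
          rw [Real.exp_sub, Real.exp_log hrpos, ENNReal.ofReal_div_of_pos hrpos,
            ENNReal.ofReal_toReal htop.ne, div_eq_mul_inv]
          gcongr
      _ = ∫⁻ i, r i * (Φ i * (r i)⁻¹) ∂P :=
          (lintegral_rnDeriv_mul hQP (hΦ.mul hr_meas.inv).aemeasurable).symm
      _ ≤ ∫⁻ i, Φ i ∂P := by
          refine lintegral_mono fun i => ?_
          calc r i * (Φ i * (r i)⁻¹) = Φ i * (r i * (r i)⁻¹) := by ring
            _ ≤ Φ i * 1 := by gcongr; exact ENNReal.mul_inv_le_one _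
            _ = Φ i := mul_one _
      _ ≤ _ := hΦc
  have hexp_int : Integrable (fun i => Real.exp (g i - Real.log (r i).toReal)) Q := by
    refine ⟨Real.continuous_exp.comp_aestronglyMeasurable hdiff.aestronglyMeasurable, ?_⟩
    rw [hasFiniteIntegral_iff_ofReal (ae_of_all _ fun i => Real.exp_nonneg _)]
    exact hlin.trans_lt ENNReal.ofReal_lt_top
  have hexp : ∫ i, Real.exp (g i - Real.log (r i).toReal) ∂Q ≤ c := by
    rw [integral_eq_lintegral_of_nonneg_ae (ae_of_all _ fun i => Real.exp_nonneg _) hexp_int.1]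
    exact ENNReal.toReal_le_of_le_ofReal hc.le hlin
  have hmono : ∫ i, (g i - Real.log (r i).toReal) ∂Q ≤
      ∫ i, (Real.exp (g i - Real.log (r i).toReal) * c⁻¹ + (Real.log c - 1)) ∂Q := by
    refine integral_mono hdiff ((hexp_int.mul_const _).add (integrable_const _)) fun i => ?_
    have := Real.add_one_le_exp (g i - Real.log (r i).toReal - Real.log c)
    rw [Real.exp_sub, Real.exp_log hc, div_eq_mul_inv] at this
    show g i - Real.log (r i).toReal ≤ _
    linarith
  rw [integral_sub hg hllr, integral_add (hexp_int.mul_const _) (integrable_const _),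
    integral_mul_const] at hmono
  have h1 : (∫ i, Real.exp (g i - Real.log (r i).toReal) ∂Q) * c⁻¹ ≤ 1 := by
    rw [← div_eq_mul_inv]
    exact div_le_one_of_le₀ hexp hc.le
  simp only [integral_const, probReal_univ, one_smul] at hmono
  linarith

lemma mul_klBin_integral_le {ι : Type*} [MeasurableSpace ι] {Q P : Measure ι}
    [IsProbabilityMeasure Q] [IsProbabilityMeasure P] (hQP : Q ≪ P)
    (hllr : Integrable (fun i => Real.log ((Q.rnDeriv P) i).toReal) Q)
    {q p : ι → ℝ} (hq : Measurable q) (hp : Measurable p) (hq01 : ∀ i, q i ∈ Set.Icc (0 : ℝ) 1)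
    (hp01 : ∀ i, p i ∈ Set.Icc (0 : ℝ) 1) {m : ℕ} {c : ℝ} (hc : 0 < c)
    (hΦ : ∫⁻ i, expKl m (q i) (p i) ∂P ≤ ENNReal.ofReal c) :
    m * klBin (∫ i, q i ∂Q) (∫ i, p i ∂Q) ≤
      ∫ i, Real.log ((Q.rnDeriv P) i).toReal ∂Q + Real.log c := by
  have h_int : ∀ {f : ι → ℝ}, Measurable f → (∀ i, f i ∈ Set.Icc (0 : ℝ) 1) → Integrable f Q :=
    fun hf h01 => Integrable.of_bound hf.aestronglyMeasurable 1 <| ae_of_all _ fun i => by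
      rw [Real.norm_eq_abs, abs_of_nonneg (h01 i).1]
      exact (h01 i).2
  have hzero : ∀ {f : ι → ℝ}, Measurable f → (∀ i, f i ∈ Set.Icc (0 : ℝ) 1) →
      ∀ᵐ i ∂Q, ∫ i, f i ∂Q = 0 → f i = 0 := by
    intro f hf h01
    by_cases h : ∫ i, f i ∂Q = 0
    · filter_upwards [(integral_eq_zero_iff_of_nonneg (fun i => (h01 i).1) (h_int hf h01)).1 h]
        with i hi _ using hi
    · exact ae_of_all _ fun i hi => absurd hi h
  have hsymm : ∀ {f : ι → ℝ}, (∀ i, f i ∈ Set.Icc (0 : ℝ) 1) →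
      ∀ i, 1 - f i ∈ Set.Icc (0 : ℝ) 1 :=
    fun h i => ⟨by linarith [(h i).2], by linarith [(h i).1]⟩
  have hone_sub : ∀ {f : ι → ℝ}, Integrable f Q → ∫ i, (1 - f i) ∂Q = 1 - ∫ i, f i ∂Q := by
    intro f hf
    rw [integral_sub (integrable_const _) hf]
    simp
  have hqi := h_int hq hq01
  have hpi := h_int hp hp01
  have hΦ_meas : Measurable fun i => expKl m (q i) (p i) :=
    (measurable_expKl m).comp (hq.prodMk hp)
  have hfin : ∀ᵐ i ∂Q, expKl m (q i) (p i) < ⊤ :=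
    hQP.ae_le (ae_lt_top hΦ_meas (hΦ.trans_lt ENNReal.ofReal_lt_top).ne)
  have hq0 := hzero hq hq01
  have hp0 := hzero hp hp01
  have hq1 := hzero (hq.const_sub 1) (hsymm hq01)
  have hp1 := hzero (hp.const_sub 1) (hsymm hp01)
  have hqn : 0 ≤ ∫ i, q i ∂Q := integral_nonneg fun i => (hq01 i).1
  have hpn : 0 ≤ ∫ i, p i ∂Q := integral_nonneg fun i => (hp01 i).1
  have hqn1 : 0 ≤ ∫ i, (1 - q i) ∂Q := integral_nonneg fun i => (hsymm hq01 i).1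
  have hpn1 : 0 ≤ ∫ i, (1 - p i) ∂Q := integral_nonneg fun i => (hsymm hp01 i).1
  rw [hone_sub hqi] at hq1 hqn1
  rw [hone_sub hpi] at hp1 hpn1
  set q' := ∫ i, q i ∂Q with hq'
  set p' := ∫ i, p i ∂Q with hp'
  have hcross : ∀ᵐ i ∂Q, (p' = 0 → q i = 0) ∧ (1 - p' = 0 → 1 - q i = 0) := by
    filter_upwards [hfin, hp0, hp1] with i hi h0 h1
    have : (p i = 0 → q i = 0) ∧ (p i = 1 → q i = 1) := by
      by_contra h
      simp [expKl, h] at hi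
    exact ⟨fun h => this.1 (h0 h), fun h => by
      rw [this.2 (by linarith [h1 h])]; ring⟩
  have hac : p' = 0 → q' = 0 := fun h => by
    rw [hq', integral_congr_ae (g := fun _ => (0 : ℝ)) (hcross.mono fun i hi => hi.1 h)]
    simp
  have hac1 : 1 - p' = 0 → 1 - q' = 0 := fun h => by
    rw [hq', ← hone_sub hqi,
      integral_congr_ae (g := fun _ => (0 : ℝ)) (hcross.mono fun i hi => hi.2 h)]
    simp
  set g : ι → ℝ := fun i => m * (q i * Real.log (q' / p') + (q i - p i * (q' / p')) +
    ((1 - q i) * Real.log ((1 - q') / (1 - p')) +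
      ((1 - q i) - (1 - p i) * ((1 - q') / (1 - p'))))) with hg
  have hqi1 : Integrable (fun i => 1 - q i) Q := (integrable_const 1).sub hqi
  have hpi1 : Integrable (fun i => 1 - p i) Q := (integrable_const 1).sub hpi
  have hA := hqi.mul_const (Real.log (q' / p'))
  have hB := hpi.mul_const (q' / p')
  have hA1 := hqi1.mul_const (Real.log ((1 - q') / (1 - p')))
  have hB1 := hpi1.mul_const ((1 - q') / (1 - p'))
  have hC : Integrable (fun i => q i - p i * (q' / p')) Q := hqi.sub hB
  have hC1 : Integrable (fun i => (1 - q i) - (1 - p i) * ((1 - q') / (1 - p'))) Q :=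
    hqi1.sub hB1
  have hE : Integrable (fun i => q i * Real.log (q' / p') + (q i - p i * (q' / p'))) Q :=
    hA.add hC
  have hE1 : Integrable (fun i => (1 - q i) * Real.log ((1 - q') / (1 - p')) +
      ((1 - q i) - (1 - p i) * ((1 - q') / (1 - p')))) Q := hA1.add hC1
  have hg_int : Integrable g Q := (hE.add hE1).const_mul _
  have hg_val : ∫ i, g i ∂Q = m * klBin q' p' := by
    have h1 : q' - p' * (q' / p') = 0 := by
      by_cases h : p' = 0
      · simp [h, hac h]
      · field_simp; ring
    have h2 : (1 - q') - (1 - p') * ((1 - q') / (1 - p')) = 0 := by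
      by_cases h : 1 - p' = 0
      · simp [h, hac1 h]
      · field_simp; ring
    have h3 : ∫ i, (q i * Real.log (q' / p') + (q i - p i * (q' / p'))) ∂Q =
        q' * Real.log (q' / p') := by
      rw [integral_add hA hC, integral_sub hqi hB, integral_mul_const,
        integral_mul_const, ← hq', ← hp', h1, add_zero]
    have h4 : ∫ i, ((1 - q i) * Real.log ((1 - q') / (1 - p')) +
        ((1 - q i) - (1 - p i) * ((1 - q') / (1 - p')))) ∂Q =
        (1 - q') * Real.log ((1 - q') / (1 - p')) := by
      rw [integral_add hA1 hC1, integral_sub hqi1 hB1, integral_mul_const,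
        integral_mul_const, hone_sub hqi, hone_sub hpi, ← hq', ← hp', h2, add_zero]
    rw [hg, integral_const_mul, integral_add hE hE1, h3, h4, klBin]
  rw [← hg_val]
  refine integral_sub_log_rnDeriv_le hQP hllr hg_int hΦ_meas ?_ hc hΦ
  filter_upwards [hfin, hq0, hp0, hq1, hp1] with i hi hq0 hp0 hq1 hp1
  have hi' : (p i = 0 → q i = 0) ∧ (p i = 1 → q i = 1) := by
    by_contra h
    simp [expKl, h] at hi
  rw [expKl, if_pos hi']
  refine ENNReal.ofReal_le_ofReal (Real.exp_le_exp.2 ?_)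
  refine mul_le_mul_of_nonneg_left (add_le_add ?_ ?_) (Nat.cast_nonneg m)
  · exact mul_log_div_add_sub_le (hq01 i).1 (hp01 i).1 hqn hpn hi'.1 hq0 hp0
  · exact mul_log_div_add_sub_le (hsymm hq01 i).1 (hsymm hp01 i).1 hqn1 hpn1
      (fun h => by rw [hi'.2 (by linarith)]; ring) hq1 hp1

/-- PAC-Bayesian theorem: with probability at least `1 - δ` over `S ∼ D^m`,
simultaneously for all posteriors `Q`,
`kl(E_{f∼Q} E_{L,S}(f) ‖ E_{f∼Q} E_{L,D}(f)) ≤ (1/m)·[KL(Q‖P) + ln(ξ(m)/δ)]`. -/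
theorem statement10 {X ι : Type*} [MeasurableSpace X] [MeasurableSpace ι]
    (D : Measure (X × ℝ)) [IsProbabilityMeasure D]
    (hY : ∀ᵐ p ∂D, p.2 = 1 ∨ p.2 = -1)
    (F : ι → X → ℝ) (hF : ∀ i x, F i x ∈ Set.Icc (-1 : ℝ) 1)
    (L : ℝ → ℝ → ℝ)
    (hL : ∀ a ∈ Set.Icc (-1 : ℝ) 1, ∀ y : ℝ, y = 1 ∨ y = -1 → L a y ∈ Set.Icc (0 : ℝ) 1)
    (hLmeas : Measurable fun q : ι × (X × ℝ) => L (F q.1 q.2.1) q.2.2)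
    (P : Measure ι) [IsProbabilityMeasure P]
    (δ : ℝ) (hδ : δ ∈ Set.Ioc (0 : ℝ) 1)
    (m : ℕ) (hm : 0 < m) :
    ENNReal.ofReal (1 - δ) ≤
      (Measure.pi fun _ : Fin m => D)
        {S | ∀ Q : Measure ι, IsProbabilityMeasure Q →
          ((klBin (∫ i, empLoss L F S i ∂Q) (∫ i, trueLoss L F D i ∂Q) : ℝ) : EReal) ≤
            (((m : ℝ)⁻¹ : ℝ) : EReal) *
              (klDivE Q P + ((Real.log (xi m / δ) : ℝ) : EReal))} := by
  obtain ⟨hδ0, -⟩ := hδ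
  have hm' : (0 : ℝ) < m := by exact_mod_cast hm
  have hxi : 0 < xi m := zero_lt_one.trans_le (one_le_xi m)
  have hc : 0 < xi m / δ := div_pos hxi hδ0
  have hL01 : ∀ i (z : X × ℝ), (z.2 = 1 ∨ z.2 = -1) → L (F i z.1) z.2 ∈ Set.Icc (0 : ℝ) 1 :=
    fun i z hz => hL _ (hF i z.1) _ hz
  have hLi : ∀ i, Measurable fun z : X × ℝ => L (F i z.1) z.2 := fun i =>
    hLmeas.comp measurable_prodMk_left
  have hemp : Measurable fun z : (Fin m → X × ℝ) × ι => empLoss L F z.1 z.2 := by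
    unfold empLoss
    refine Measurable.const_mul (Finset.measurable_sum _ fun k _ => ?_) _
    exact hLmeas.comp (measurable_snd.prodMk ((measurable_pi_apply k).comp measurable_fst))
  have htrue : Measurable (trueLoss L F D) :=
    (hLmeas.stronglyMeasurable.integral_prod_right (ν := D)).measurable
  have htrue01 : ∀ i, trueLoss L F D i ∈ Set.Icc (0 : ℝ) 1 := by
    intro i
    have hae : ∀ᵐ z ∂D, L (F i z.1) z.2 ∈ Set.Icc (0 : ℝ) 1 := hY.mono fun z hz => hL01 i z hz
    refine ⟨integral_nonneg_of_ae (hae.mono fun z hz => hz.1), ?_⟩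
    have := integral_mono_of_nonneg (hae.mono fun z hz => hz.1) (integrable_const (1 : ℝ))
      (hae.mono fun z hz => hz.2)
    simpa [trueLoss] using this
  set μ : Measure (Fin m → X × ℝ) := Measure.pi fun _ => D with hμ
  have hΦ : Measurable fun z : (Fin m → X × ℝ) × ι =>
      expKl m (empLoss L F z.1 z.2) (trueLoss L F D z.2) :=
    (measurable_expKl m).comp (hemp.prodMk (htrue.comp measurable_snd))
  have hΨ : Measurable fun S : Fin m → X × ℝ =>
      ∫⁻ i, expKl m (empLoss L F S i) (trueLoss L F D i) ∂P := hΦ.lintegral_prod_right'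
  have hmean : ∫⁻ S, ∫⁻ i, expKl m (empLoss L F S i) (trueLoss L F D i) ∂P ∂μ ≤
      ENNReal.ofReal (xi m) := by
    rw [lintegral_lintegral_swap hΦ.aemeasurable]
    calc _ ≤ ∫⁻ _, ENNReal.ofReal (xi m) ∂P := lintegral_mono fun i =>
          lintegral_expKl_le_xi (hLi i) (hY.mono fun z hz => hL01 i z hz) hm
      _ = _ := by simp
  have hmarkov : μ {S | ENNReal.ofReal (xi m / δ) ≤
      ∫⁻ i, expKl m (empLoss L F S i) (trueLoss L F D i) ∂P} ≤ ENNReal.ofReal δ := by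
    refine (meas_ge_le_lintegral_div hΨ.aemeasurable (ENNReal.ofReal_pos.2 hc).ne'
      ENNReal.ofReal_ne_top).trans ((ENNReal.div_le_div_right hmean _).trans_eq ?_)
    rw [← ENNReal.ofReal_div_of_pos hc]
    congr 1
    field_simp
  have hlabels : ∀ᵐ S ∂μ, ∀ k, (S k).2 = 1 ∨ (S k).2 = -1 :=
    ae_all_iff.2 fun k =>
      (Measure.tendsto_eval_ae_ae (μ := fun _ : Fin m => D) (i := k)).eventually hY
  have hgood : ENNReal.ofReal (1 - δ) ≤
      μ {S | ENNReal.ofReal (xi m / δ) ≤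
        ∫⁻ i, expKl m (empLoss L F S i) (trueLoss L F D i) ∂P}ᶜ := by
    rw [prob_compl_eq_one_sub (measurableSet_le measurable_const hΨ),
      ENNReal.ofReal_sub _ hδ0.le, ENNReal.ofReal_one]
    exact tsub_le_tsub_left hmarkov 1
  refine hgood.trans (measure_mono_ae ?_)
  filter_upwards [hlabels] with S hS hSc
  intro Q hQ
  have hemp01 : ∀ i, empLoss L F S i ∈ Set.Icc (0 : ℝ) 1 := by
    intro i
    have h0 : 0 ≤ ∑ k, L (F i (S k).1) (S k).2 :=
      Finset.sum_nonneg fun k _ => (hL01 i (S k) (hS k)).1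
    have h1 : ∑ k, L (F i (S k).1) (S k).2 ≤ m := by
      simpa using Finset.sum_le_sum fun k (_ : k ∈ Finset.univ) => (hL01 i (S k) (hS k)).2
    exact ⟨mul_nonneg (inv_nonneg.2 hm'.le) h0, inv_mul_le_one_of_le₀ h1 hm'.le⟩
  unfold klDivE
  split_ifs with hac
  · have h := mul_klBin_integral_le hac.1 hac.2 (hemp.comp measurable_prodMk_left) htrue hemp01
      htrue01 (m := m) hc (le_of_not_ge fun h => hSc h)
    rw [← EReal.coe_add, ← EReal.coe_mul, EReal.coe_le_coe_iff, le_inv_mul_iff₀ hm']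
    exact h
  · rw [EReal.top_add_coe, EReal.coe_mul_top_of_pos (inv_pos.2 hm')]
    exact le_top
end
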